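/- Let F : ℝ^N → ℝ be a smooth solution of the associativity equations with respect to a constant symmetric invertible N×N matrix η. Define F̃ : ℝ^{N+2} → ℝ (with coordinates t⁰, t¹,…,t^N, t^{N+1}) by F̃ = (1/2)(Σ_{α,β=1}^{N} η_{αβ} t^α t^β t⁰ + (t⁰)² t^{N+1}) + F(t¹,…,t^N), and let η̃ be the (N+2)×(N+2) symmetric matrix with η̃_{0,N+1} = η̃_{N+1,0} = 1, η̃_{αβ} = η_{αβ} for 1 ≤ α,β ≤ N, and all other entries zero. Then F̃ satisfies the associativity equations with respect to η̃. -/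

import Mathlib

/-- The partial derivative `∂f/∂t^i` at `t`, for `f : ℝ^ι → ℝ`. -/
noncomputable def pd {ι : Type} [Fintype ι] [DecidableEq ι]
    (f : (ι → ℝ) → ℝ) (i : ι) (t : ι → ℝ) : ℝ :=
  fderiv ℝ f t (Pi.single i 1)

/-- The third partial derivative `∂³f/∂t^a∂t^b∂t^c` at `t`. -/
noncomputable def thd {ι : Type} [Fintype ι] [DecidableEq ι]
    (f : (ι → ℝ) → ℝ) (a b c : ι) (t : ι → ℝ) : ℝ :=
  pd (pd (pd f c) b) a t

/-- The associativity (WDVV) equations for `f` with respect to the inverse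
metric entries `ηinv`. -/
def WDVV {ι : Type} [Fintype ι] [DecidableEq ι]
    (f : (ι → ℝ) → ℝ) (ηinv : Matrix ι ι ℝ) : Prop :=
  ∀ t : ι → ℝ, ∀ α β γ δ : ι,
    (∑ l, ∑ m, thd f α β l t * ηinv l m * thd f γ δ m t) =
      ∑ l, ∑ m, thd f γ β l t * ηinv l m * thd f α δ m t

/-- The index type of the extended Frobenius structure: `0`, `1,…,N`, `N+1`. -/
abbrev ExtIdx (N : ℕ) : Type := Unit ⊕ Fin N ⊕ Unit

/-- The extended metric `η̃`: `η̃_{0,N+1} = η̃_{N+1,0} = 1`, `η̃_{αβ} = η_{αβ}`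
for middle indices, all other entries zero. -/
noncomputable def extEta {N : ℕ} (η : Matrix (Fin N) (Fin N) ℝ) :
    Matrix (ExtIdx N) (ExtIdx N) ℝ :=
  Matrix.of fun i j =>
    match i, j with
    | Sum.inl _, Sum.inr (Sum.inr _) => 1
    | Sum.inr (Sum.inr _), Sum.inl _ => 1
    | Sum.inr (Sum.inl a), Sum.inr (Sum.inl b) => η a b
    | _, _ => 0

/-- The extended prepotential
`F̃ = ½(Σ_{α,β} η_{αβ} t^α t^β t⁰ + (t⁰)² t^{N+1}) + F(t¹,…,t^N)`. -/
noncomputable def extF {N : ℕ} (η : Matrix (Fin N) (Fin N) ℝ) (F : (Fin N → ℝ) → ℝ) :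
    ((ExtIdx N) → ℝ) → ℝ :=
  fun t =>
    (1 / 2) * ((∑ α, ∑ β, η α β * t (Sum.inr (Sum.inl α)) * t (Sum.inr (Sum.inl β)))
        * t (Sum.inl ()) +
      (t (Sum.inl ())) ^ 2 * t (Sum.inr (Sum.inr ()))) +
    F (fun i => t (Sum.inr (Sum.inl i)))

section PartialDerivatives

variable {ι : Type} [Fintype ι] [DecidableEq ι]

theorem pd_add {f g : (ι → ℝ) → ℝ} (hf : Differentiable ℝ f) (hg : Differentiable ℝ g) (i : ι) :
    pd (fun t => f t + g t) i = fun t => pd f i t + pd g i t := by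
  funext t
  simp [pd, fderiv_fun_add (hf t) (hg t)]

theorem pd_mul {f g : (ι → ℝ) → ℝ} (hf : Differentiable ℝ f) (hg : Differentiable ℝ g) (i : ι) :
    pd (fun t => f t * g t) i = fun t => pd f i t * g t + f t * pd g i t := by
  funext t
  simp [pd, fderiv_fun_mul (hf t) (hg t)]
  ring

theorem pd_const (c : ℝ) (i : ι) : pd (fun _ : ι → ℝ => c) i = fun _ => 0 := by
  funext t
  simp [pd]

theorem pd_coord (i j : ι) : pd (fun t : ι → ℝ => t j) i = fun _ => if j = i then 1 else 0 := by
  funext t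
  have h : HasFDerivAt (fun t : ι → ℝ => t j) (ContinuousLinearMap.proj (R := ℝ) j) t :=
    (ContinuousLinearMap.proj (R := ℝ) (φ := fun _ : ι => ℝ) j).hasFDerivAt
  simp [pd, h.fderiv, Pi.single_apply]

theorem pd_sum {κ : Type} [Fintype κ] {f : κ → (ι → ℝ) → ℝ}
    (hf : ∀ k, Differentiable ℝ (f k)) (i : ι) :
    pd (fun t => ∑ k, f k t) i = fun t => ∑ k, pd (f k) i t := by
  funext t
  simp [pd, fderiv_fun_sum (fun k _ => hf k t)]

theorem pd_comp_reindex {κ : Type} [Fintype κ] [DecidableEq κ] (e : κ → ι)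
    {G : (κ → ℝ) → ℝ} (hG : Differentiable ℝ G) (i : ι) (t : ι → ℝ) :
    pd (fun t => G (fun k => t (e k))) i t =
      fderiv ℝ G (fun k => t (e k)) (fun k => if e k = i then 1 else 0) := by
  have h : HasFDerivAt (fun (t : ι → ℝ) (k : κ) => t (e k))
      (ContinuousLinearMap.pi fun k => ContinuousLinearMap.proj (R := ℝ) (e k)) t :=
    (ContinuousLinearMap.pi fun k =>
      ContinuousLinearMap.proj (R := ℝ) (φ := fun _ : ι => ℝ) (e k)).hasFDerivAt
  have h2 := (hG (fun k => t (e k))).hasFDerivAt.comp t h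
  change fderiv ℝ (G ∘ fun (t : ι → ℝ) (k : κ) => t (e k)) t _ = _
  rw [h2.fderiv]
  simp only [ContinuousLinearMap.comp_apply]
  congr 1
  funext k
  simp [Pi.single_apply]

theorem contDiff_pd {f : (ι → ℝ) → ℝ} (hf : ContDiff ℝ (⊤ : ℕ∞) f) (i : ι) :
    ContDiff ℝ (⊤ : ℕ∞) (pd f i) :=
  (hf.fderiv_right (m := (⊤ : ℕ∞)) (by simp)).clm_apply contDiff_const

theorem pd_comm {f : (ι → ℝ) → ℝ} (hf : ContDiff ℝ (⊤ : ℕ∞) f) (i j : ι) :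
    pd (pd f i) j = pd (pd f j) i := by
  funext t
  have hd : DifferentiableAt ℝ (fderiv ℝ f) t :=
    ((hf.fderiv_right (m := (⊤ : ℕ∞)) (by simp)).differentiable (by simp)) t
  have key : ∀ a b : ι, pd (pd f a) b t =
      fderiv ℝ (fderiv ℝ f) t (Pi.single b 1) (Pi.single a 1) := by
    intro a b
    have h := hd.hasFDerivAt.clm_apply (hasFDerivAt_const (Pi.single a (1 : ℝ)) t)
    change fderiv ℝ (fun y => fderiv ℝ f y (Pi.single a 1)) t _ = _
    rw [h.fderiv]
    simp
  rw [key, key]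
  have hs : IsSymmSndFDerivAt ℝ f t :=
    hf.contDiffAt.isSymmSndFDerivAt (by simpa using WithTop.coe_le_coe.mpr (le_top : (2 : ℕ∞) ≤ ⊤))
  exact hs _ _

theorem thd_swap_right {f : (ι → ℝ) → ℝ} (hf : ContDiff ℝ (⊤ : ℕ∞) f) (a b c : ι) :
    thd f a b c = thd f a c b := by
  funext t
  simp only [thd, pd_comm hf c b]

theorem thd_swap_left {f : (ι → ℝ) → ℝ} (hf : ContDiff ℝ (⊤ : ℕ∞) f) (a b c : ι) :
    thd f a b c = thd f b a c := by
  funext t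
  simp only [thd, pd_comm (contDiff_pd hf c) b a]

end PartialDerivatives

section Extension

variable {N : ℕ}

/-- The restriction of an extended point to its middle coordinates. -/
def midPoint (t : ExtIdx N → ℝ) : Fin N → ℝ := fun i => t (Sum.inr (Sum.inl i))

theorem differentiable_comp_midPoint {G : (Fin N → ℝ) → ℝ} (hG : Differentiable ℝ G) :
    Differentiable ℝ (fun t : ExtIdx N → ℝ => G (midPoint t)) := by
  unfold midPoint
  fun_prop

theorem pd_comp_midPoint_zero {G : (Fin N → ℝ) → ℝ} (hG : Differentiable ℝ G) (u : Unit) :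
    pd (fun t : ExtIdx N → ℝ => G (midPoint t)) (Sum.inl u) = fun _ => 0 := by
  funext t
  refine (pd_comp_reindex (fun i : Fin N => (Sum.inr (Sum.inl i) : ExtIdx N)) hG _ t).trans ?_
  simp only [reduceCtorEq, if_false]
  exact map_zero (fderiv ℝ G (midPoint t))

theorem pd_comp_midPoint_last {G : (Fin N → ℝ) → ℝ} (hG : Differentiable ℝ G) (u : Unit) :
    pd (fun t : ExtIdx N → ℝ => G (midPoint t)) (Sum.inr (Sum.inr u)) = fun _ => 0 := by
  funext t
  refine (pd_comp_reindex (fun i : Fin N => (Sum.inr (Sum.inl i) : ExtIdx N)) hG _ t).trans ?_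
  simp only [reduceCtorEq, Sum.inr.injEq, if_false]
  exact map_zero (fderiv ℝ G (midPoint t))

theorem pd_comp_midPoint_mid {G : (Fin N → ℝ) → ℝ} (hG : Differentiable ℝ G) (a : Fin N) :
    pd (fun t : ExtIdx N → ℝ => G (midPoint t)) (Sum.inr (Sum.inl a)) =
      fun t => pd G a (midPoint t) := by
  funext t
  refine (pd_comp_reindex (fun i : Fin N => (Sum.inr (Sum.inl i) : ExtIdx N)) hG _ t).trans ?_
  unfold pd midPoint
  congr 1
  funext k
  simp [Pi.single_apply]

/-- The fully covariant structure constants of the extended algebra, built from the metric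
and the middle structure constants. -/
def extC (η : Matrix (Fin N) (Fin N) ℝ) (C : Fin N → Fin N → Fin N → ℝ) :
    ExtIdx N → ExtIdx N → ExtIdx N → ℝ
  | Sum.inl _, Sum.inl _, Sum.inr (Sum.inr _) => 1
  | Sum.inl _, Sum.inr (Sum.inr _), Sum.inl _ => 1
  | Sum.inr (Sum.inr _), Sum.inl _, Sum.inl _ => 1
  | Sum.inl _, Sum.inr (Sum.inl a), Sum.inr (Sum.inl b) => η a b
  | Sum.inr (Sum.inl a), Sum.inl _, Sum.inr (Sum.inl b) => η a b
  | Sum.inr (Sum.inl a), Sum.inr (Sum.inl b), Sum.inl _ => η a b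
  | Sum.inr (Sum.inl a), Sum.inr (Sum.inl b), Sum.inr (Sum.inl c) => C a b c
  | _, _, _ => 0

theorem extF_eq (η : Matrix (Fin N) (Fin N) ℝ) (F : (Fin N → ℝ) → ℝ) :
    extF η F = fun t =>
      (1 / 2) * ((∑ α, ∑ β, η α β * t (Sum.inr (Sum.inl α)) * t (Sum.inr (Sum.inl β)))
          * t (Sum.inl ()) + t (Sum.inl ()) * t (Sum.inl ()) * t (Sum.inr (Sum.inr ()))) +
        F (midPoint t) := by
  funext t
  simp only [extF, sq]
  rfl

theorem pd_extF_zero (η : Matrix (Fin N) (Fin N) ℝ)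
    {F : (Fin N → ℝ) → ℝ} (hF : Differentiable ℝ F) :
    pd (extF η F) (Sum.inl ()) = fun t =>
      (1 / 2) * (∑ α, ∑ β, η α β * t (Sum.inr (Sum.inl α)) * t (Sum.inr (Sum.inl β))) +
        t (Sum.inl ()) * t (Sum.inr (Sum.inr ())) := by
  have := differentiable_comp_midPoint hF
  rw [extF_eq]
  simp (disch := first | assumption | (intros; fun_prop)) only
    [pd_add, pd_mul, pd_sum, pd_const, pd_coord, pd_comp_midPoint_zero]
  funext t
  simp
  ring

theorem pd_extF_last (η : Matrix (Fin N) (Fin N) ℝ)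
    {F : (Fin N → ℝ) → ℝ} (hF : Differentiable ℝ F) :
    pd (extF η F) (Sum.inr (Sum.inr ())) = fun t => (1 / 2) * (t (Sum.inl ()) * t (Sum.inl ())) := by
  have := differentiable_comp_midPoint hF
  rw [extF_eq]
  simp (disch := first | assumption | (intros; fun_prop)) only
    [pd_add, pd_mul, pd_sum, pd_const, pd_coord, pd_comp_midPoint_last]
  funext t
  simp

theorem pd_extF_mid {η : Matrix (Fin N) (Fin N) ℝ} (hη : η.IsSymm)
    {F : (Fin N → ℝ) → ℝ} (hF : Differentiable ℝ F) (a : Fin N) :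
    pd (extF η F) (Sum.inr (Sum.inl a)) = fun t =>
      (∑ β, η a β * t (Sum.inr (Sum.inl β))) * t (Sum.inl ()) + pd F a (midPoint t) := by
  have := differentiable_comp_midPoint hF
  rw [extF_eq]
  simp (disch := first | assumption | (intros; fun_prop)) only
    [pd_add, pd_mul, pd_sum, pd_const, pd_coord, pd_comp_midPoint_mid]
  funext t
  simp [Finset.sum_add_distrib, hη.apply a]
  ring

theorem thd_extF {η : Matrix (Fin N) (Fin N) ℝ} (hη : η.IsSymm)
    {F : (Fin N → ℝ) → ℝ} (hF : ContDiff ℝ (⊤ : ℕ∞) F) (a b c : ExtIdx N) (t : ExtIdx N → ℝ) :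
    thd (extF η F) a b c t = extC η (fun i j k => thd F i j k (midPoint t)) a b c := by
  have h0 : Differentiable ℝ F := hF.differentiable (by simp)
  have h1 (i) : Differentiable ℝ (pd F i) := (contDiff_pd hF i).differentiable (by simp)
  have h2 (i j) : Differentiable ℝ (pd (pd F i) j) :=
    (contDiff_pd (contDiff_pd hF i) j).differentiable (by simp)
  have h1_mid (i) := differentiable_comp_midPoint (h1 i)
  have h2_mid (i j) := differentiable_comp_midPoint (h2 i j)
  unfold thd
  rcases c with ⟨⟩ | c | ⟨⟩
  · rw [pd_extF_zero η h0]
    rcases b with ⟨⟩ | b | ⟨⟩ <;> rcases a with ⟨⟩ | a | ⟨⟩ <;>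
    simp (disch := intros; fun_prop) only [pd_add, pd_mul, pd_sum, pd_const, pd_coord] <;>
    simp [extC, Finset.sum_add_distrib, hη.apply]
    rw [hη.apply]
    ring
  · rw [pd_extF_mid hη h0]
    rcases b with ⟨⟩ | b | ⟨⟩ <;> rcases a with ⟨⟩ | a | ⟨⟩ <;>
    simp (disch := first | apply h1 | apply h2 | (intros; fun_prop)) only
      [pd_add, pd_mul, pd_sum, pd_const, pd_coord, pd_comp_midPoint_zero,
        pd_comp_midPoint_mid, pd_comp_midPoint_last] <;>
    simp [extC, hη.apply]
  · rw [pd_extF_last η h0]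
    rcases b with ⟨⟩ | b | ⟨⟩ <;> rcases a with ⟨⟩ | a | ⟨⟩ <;>
    simp (disch := intros; fun_prop) only [pd_add, pd_mul, pd_const, pd_coord] <;>
    simp [extC]
    norm_num

theorem extEta_inv {η : Matrix (Fin N) (Fin N) ℝ} (hdet : IsUnit η.det) :
    (extEta η)⁻¹ = extEta η⁻¹ := by
  apply Matrix.inv_eq_right_inv
  have h := Matrix.mul_nonsing_inv η hdet
  ext i j
  rcases i with ⟨⟩ | i | ⟨⟩ <;> rcases j with ⟨⟩ | j | ⟨⟩ <;>
    simp [Matrix.mul_apply, extEta, Matrix.one_apply]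
  have := congrFun (congrFun h i) j
  simpa [Matrix.mul_apply, Matrix.one_apply] using this

theorem sum_extEta (η : Matrix (Fin N) (Fin N) ℝ) (x y : ExtIdx N → ℝ) :
    ∑ l, ∑ m, x l * extEta η l m * y m =
      x (Sum.inl ()) * y (Sum.inr (Sum.inr ())) + x (Sum.inr (Sum.inr ())) * y (Sum.inl ()) +
        ∑ l, ∑ m, x (Sum.inr (Sum.inl l)) * η l m * y (Sum.inr (Sum.inl m)) := by
  simp [extEta]
  ring

theorem sum_mul_inv_mul_left {η : Matrix (Fin N) (Fin N) ℝ} (hdet : IsUnit η.det)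
    (y : Fin N → ℝ) (b : Fin N) : ∑ l, ∑ m, η b l * η⁻¹ l m * y m = y b := by
  have h := congrFun (congrArg (Matrix.mulVec · y) (Matrix.mul_nonsing_inv η hdet)) b
  beta_reduce at h
  rw [Matrix.one_mulVec] at h
  simp only [Matrix.mulVec, dotProduct, Matrix.mul_apply, Finset.sum_mul] at h
  rw [Finset.sum_comm, h]

theorem sum_mul_inv_mul_right {η : Matrix (Fin N) (Fin N) ℝ} (hη : η.IsSymm)
    (hdet : IsUnit η.det) (x : Fin N → ℝ) (b : Fin N) :
    ∑ l, ∑ m, x l * η⁻¹ l m * η b m = x b := by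
  have hinv : η⁻¹.IsSymm := by
    rw [Matrix.IsSymm, Matrix.transpose_nonsing_inv, hη.eq]
  rw [Finset.sum_comm, ← sum_mul_inv_mul_left hdet x b]
  refine Finset.sum_congr rfl fun l _ => Finset.sum_congr rfl fun m _ => ?_
  rw [hinv.apply m l]
  ring

end Extension

/-- If a smooth `F` satisfies the associativity equations w.r.t. a
constant symmetric invertible matrix `η`, then `F̃` satisfies the associativity
equations w.r.t. `η̃`. -/
theorem extended_prepotential_WDVV
    (N : ℕ) (η : Matrix (Fin N) (Fin N) ℝ) (hsym : η.IsSymm) (hdet : IsUnit η.det)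
    (F : (Fin N → ℝ) → ℝ) (hF : ContDiff ℝ (⊤ : ℕ∞) F)
    (hWDVV : WDVV F η⁻¹) :
    WDVV (extF η F) (extEta η)⁻¹ := by
  intro t α β γ δ
  have hW := hWDVV (midPoint t)
  have hl (a b c) : thd F a b c (midPoint t) = thd F b a c (midPoint t) :=
    congrFun (thd_swap_left hF a b c) _
  have hr (a b c) : thd F a b c (midPoint t) = thd F a c b (midPoint t) :=
    congrFun (thd_swap_right hF a b c) _
  simp only [thd_extF hsym hF, extEta_inv hdet, sum_extEta]
  generalize hC : (fun i j k => thd F i j k (midPoint t)) = C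
  have hC' (i j k) : thd F i j k (midPoint t) = C i j k := by rw [← hC]
  simp only [hC'] at hW hl hr
  rcases α with ⟨⟩ | α | ⟨⟩ <;> rcases β with ⟨⟩ | β | ⟨⟩ <;>
    rcases γ with ⟨⟩ | γ | ⟨⟩ <;> rcases δ with ⟨⟩ | δ | ⟨⟩ <;>
    simp [extC, sum_mul_inv_mul_left hdet, sum_mul_inv_mul_right hsym hdet] <;>
    first
      | exact hsym.apply _ _
      | exact hW _ _ _ _
      | grind
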